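/- arXiv:2602.13794 — 3 statements merged into one kernel-verified Lean document; each statement's English description precedes it below -/
import Mathlib

section
/- Let R be a ring and X a module of projective dimension at most n whose class B = X^{⊥∞} is closed under direct sums, with X ∈ B. Suppose every module in B ∩ Gen(X) is X-generated and the cotorsion pair ({}^{⊥1}B, B) is complete. If M ∈ {}^{⊥1}B ∩ B and M ∈ Gen(X), then every Add(X)-precover of M is surjective with kernel in B, and hence M ∈ Add(X). -/
open CategoryTheory Limits CategoryTheory.Abelian

universe u

namespace CategoryTheory.Abelian.Ext

variable {C : Type*} [Category* C] [Abelian C] [HasExt C]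

/-- If `Y` is a retract of `Z`, then `Ext X Y i` vanishes as soon as `Ext X Z i` does. -/
lemma subsingleton_of_retract {X Y Z : C} (r : Retract Y Z) {i : ℕ} (h : Subsingleton (Ext X Z i)) :
    Subsingleton (Ext X Y i) := by
  refine subsingleton_of_forall_eq 0 fun a ↦ ?_
  rw [← a.comp_mk₀_id, ← r.retract, ← mk₀_comp_mk₀,
    ← comp_assoc_of_second_deg_zero, Subsingleton.elim (a.comp (mk₀ r.i) (add_zero i)) 0, zero_comp]

/-- In a short exact sequence, `Ext X S.X₁` vanishes in positive degrees if it does for `S.X₂` and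
`S.X₃` and every morphism `X ⟶ S.X₃` lifts to `S.X₂`. -/
lemma subsingleton_X₁_of_lift {X : C} {S : ShortComplex C} (hS : S.ShortExact)
    (h₂ : ∀ i : ℕ, 0 < i → Subsingleton (Ext X S.X₂ i))
    (h₃ : ∀ i : ℕ, 0 < i → Subsingleton (Ext X S.X₃ i))
    (hlift : ∀ f : X ⟶ S.X₃, ∃ k : X ⟶ S.X₂, k ≫ S.g = f) {i : ℕ} (hi : 0 < i) :
    Subsingleton (Ext X S.X₁ i) := by
  refine subsingleton_of_forall_eq 0 fun a ↦ ?_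
  have := h₂ i hi
  obtain ⟨j, rfl⟩ := Nat.exists_eq_succ_of_ne_zero hi.ne'
  obtain ⟨b, rfl⟩ := covariant_sequence_exact₁ X hS a (Subsingleton.elim _ _) rfl
  obtain rfl | hj := Nat.eq_zero_or_pos j
  · obtain ⟨f, rfl⟩ := (mk₀_bijective _ _).2 b
    obtain ⟨k, rfl⟩ := hlift f
    rw [← mk₀_comp_mk₀, comp_assoc_of_second_deg_zero, hS.comp_extClass, comp_zero]
  · have := h₃ j hj
    rw [Subsingleton.elim b 0, zero_comp]

/-- A short exact sequence with vanishing `Ext S.X₃ S.X₁ 1` splits. -/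
lemma exists_section_of_subsingleton {S : ShortComplex C} (hS : S.ShortExact)
    (h : Subsingleton (Ext S.X₃ S.X₁ 1)) : ∃ s : S.X₃ ⟶ S.X₂, s ≫ S.g = 𝟙 S.X₃ := by
  obtain ⟨b, hb⟩ := covariant_sequence_exact₃ S.X₃ hS (mk₀ (𝟙 S.X₃)) (zero_add 1)
    (Subsingleton.elim _ _)
  obtain ⟨s, rfl⟩ := (mk₀_bijective _ _).2 b
  exact ⟨s, (mk₀_bijective _ _).1 (by rw [← mk₀_comp_mk₀, hb])⟩

end CategoryTheory.Abelian.Ext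

/-- Let `X` have projective dimension at most `n`, `B = X^{⊥∞}` closed
under direct sums with `X ∈ B`; suppose every module in `B ∩ Gen(X)` is `X`-generated and
the cotorsion pair `(^{⊥1}B, B)` is complete.  If `M ∈ ^{⊥1}B ∩ B` and `M ∈ Gen(X)`, then
every `Add(X)`-precover of `M` is surjective with kernel in `B`, and hence `M ∈ Add(X)`. -/
theorem stmt4 {R : Type u} [Ring R] [HasExt.{u} (ModuleCat.{u} R)]
    (n : ℕ) (X : ModuleCat.{u} R)
    (B AddX GenX perp1 : ModuleCat.{u} R → Prop)
    (hBdef : ∀ N, B N ↔ ∀ i : ℕ, 0 < i → Subsingleton (Ext X N i))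
    (hAdd : ∀ Y, AddX Y ↔ ∃ (ι : Type u) (s : Y →ₗ[R] (ι →₀ ↥X)) (p : (ι →₀ ↥X) →ₗ[R] Y),
      p.comp s = LinearMap.id)
    (hGen : ∀ Y, GenX Y ↔ ∃ (ι : Type u) (g : (ι →₀ ↥X) →ₗ[R] Y), Function.Surjective g)
    (hperp1 : ∀ Y, perp1 Y ↔ ∀ C, B C → Subsingleton (Ext Y C 1))
    (hpd : ∀ (N : ModuleCat.{u} R) (i : ℕ), n < i → Subsingleton (Ext X N i))
    (hBsum : ∀ (ι : Type u) (f : ι → ModuleCat.{u} R), (∀ i, B (f i)) →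
      B (ModuleCat.of R (DirectSum ι (fun i => ↥(f i)))))
    (hXB : B X)
    (hBGen : ∀ N, B N → GenX N → GenX N)
    (hpreenv : ∀ M : ModuleCat.{u} R, ∃ (N : ModuleCat.{u} R) (f : M →ₗ[R] N),
      Function.Injective f ∧ B N ∧ perp1 (ModuleCat.of R (↥N ⧸ LinearMap.range f)))
    (hprecov : ∀ M : ModuleCat.{u} R, ∃ (P : ModuleCat.{u} R) (g : P →ₗ[R] M),
      Function.Surjective g ∧ perp1 P ∧ B (ModuleCat.of R (LinearMap.ker g)))
    (M : ModuleCat.{u} R) (hM1 : perp1 M) (hM2 : B M) (hM3 : GenX M) :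
    ∀ (Y : ModuleCat.{u} R) (g : Y →ₗ[R] M), AddX Y →
      (∀ (F : ModuleCat.{u} R) (f : F →ₗ[R] M), AddX F → ∃ h : F →ₗ[R] Y, g.comp h = f) →
      Function.Surjective g ∧ B (ModuleCat.of R (LinearMap.ker g)) ∧ AddX M := by
  intro Y g hY hg
  have hFree (ι : Type u) : AddX (ModuleCat.of R (ι →₀ X)) :=
    (hAdd _).2 ⟨ι, LinearMap.id, LinearMap.id, LinearMap.id_comp _⟩
  have hAddX : AddX X := (hAdd _).2 ⟨PUnit, Finsupp.lsingle PUnit.unit,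
    Finsupp.lapply PUnit.unit, by ext; simp⟩
  have hsurj : Function.Surjective g := by
    obtain ⟨ι, q, hq⟩ := (hGen M).1 hM3
    obtain ⟨h, hh⟩ := hg (ModuleCat.of R (ι →₀ X)) q (hFree ι)
    exact fun m ↦ (hq m).imp' h fun x hx ↦ by rw [← hx, ← hh]; rfl
  have hS := LinearMap.shortExact_shortComplexKer hsurj
  obtain ⟨ι, s, p, hps⟩ := (hAdd Y).1 hY
  have hBY (i : ℕ) (hi : 0 < i) : Subsingleton (Ext X Y i) := by
    classical
    let e := finsuppLEquivDirectSum R X ι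
    refine Ext.subsingleton_of_retract
      (Z := ModuleCat.of R (DirectSum ι fun _ ↦ X)) ⟨ModuleCat.ofHom (e.toLinearMap ∘ₗ s),
        ModuleCat.ofHom (p ∘ₗ e.symm.toLinearMap), ?_⟩
      ((hBdef _).1 (hBsum ι (fun _ ↦ X) fun _ ↦ hXB) i hi)
    ext y
    simpa using LinearMap.congr_fun hps y
  have hBK : B (ModuleCat.of R (LinearMap.ker g)) :=
    (hBdef _).2 fun i hi ↦ Ext.subsingleton_X₁_of_lift hS hBY ((hBdef M).1 hM2) (fun f ↦ by
      obtain ⟨h, hh⟩ := hg X f.hom hAddX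
      exact ⟨ModuleCat.ofHom h, ModuleCat.hom_ext hh⟩) hi
  obtain ⟨t, ht⟩ := Ext.exists_section_of_subsingleton hS ((hperp1 M).1 hM1 _ hBK)
  refine ⟨hsurj, hBK, (hAdd M).2 ⟨ι, s ∘ₗ t.hom, g ∘ₗ p, ?_⟩⟩
  calc (g ∘ₗ p) ∘ₗ s ∘ₗ t.hom = g ∘ₗ (p ∘ₗ s) ∘ₗ t.hom := rfl
    _ = g ∘ₗ t.hom := by rw [hps, LinearMap.id_comp]
    _ = LinearMap.id := congrArg ModuleCat.Hom.hom ht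
end

section
/- Let A be a left hereditary ring. Then every nonzero localizing subcategory and every nonzero colocalizing subcategory of D(A) contains a nonzero A-module (viewed as a stalk complex in degree 0). -/
open CategoryTheory Limits DerivedCategory Pretriangulated

universe u

universe w v

namespace Hereditary

variable {A : Type u} [Ring A]

/-- Over a left hereditary ring, quotients of injective modules are injective. -/
theorem injective_of_epi (hA : ∀ I : Submodule A A, Module.Projective A ↥I)
    {E F : ModuleCat.{u} A} (p : E ⟶ F) [Epi p] [Injective E] : Injective F := by
  have hE : Module.Injective A E := Module.injective_module_of_injective_object A E
  have hp : Function.Surjective p.hom := (ModuleCat.epi_iff_surjective p).1 inferInstance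
  have hF : Module.Baer A F := fun I g ↦ by
    have := hA I
    obtain ⟨h, hh⟩ := Module.projective_lifting_property p.hom g hp
    obtain ⟨k, hk⟩ := Module.Baer.of_injective hE I h
    exact ⟨p.hom ∘ₗ k, fun x hx ↦ by simp [hk x hx, ← hh]⟩
  have := hF.injective
  exact Module.injective_object_of_injective_module A F

/-- In an abelian category with enough injectives whose injective objects are stable under
quotients, subobjects of projective objects are projective. -/
theorem projective_of_mono_of_injective_of_epi {C : Type*} [Category* C] [Abelian C]
    [EnoughInjectives C]
    (hC : ∀ {E F : C} (p : E ⟶ F) [Epi p] [Injective E], Injective F)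
    {P Q : C} (j : P ⟶ Q) [Mono j] [Projective Q] : Projective P := by
  refine ⟨fun {M N} f e he ↦ ?_⟩
  have hI : Injective (Injective.under M) := Injective.injective_under M
  let ι : M ⟶ Injective.under M := Injective.ι M
  have hpo : IsPushout ι e (pushout.inl ι e) (pushout.inr ι e) := IsPushout.of_hasPushout ι e
  have : Injective (pushout ι e) := hC (pushout.inl ι e)
  let k : P ⟶ Injective.under M := j ≫ Projective.factorThru
    (Injective.factorThru (f ≫ pushout.inr ι e) j) (pushout.inl ι e)
  have hk : k ≫ pushout.inl ι e = f ≫ pushout.inr ι e := by simp [k]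
  have hfst : hpo.shortComplex.f ≫ biprod.fst = ι := biprod.lift_fst _ _
  have : Mono (hpo.shortComplex.f ≫ biprod.fst) := by rw [hfst]; exact Injective.ι_mono M
  have : Mono hpo.shortComplex.f := mono_of_mono _ biprod.fst
  have hw : biprod.lift k (-f) ≫ biprod.desc (pushout.inl ι e) (pushout.inr ι e) = 0 := by
    rw [biprod.lift_desc, hk, Preadditive.neg_comp, add_neg_cancel]
  obtain ⟨l, hl⟩ : ∃ l : P ⟶ M, l ≫ biprod.lift ι (-e) = biprod.lift k (-f) :=
    ⟨hpo.exact_shortComplex.lift (biprod.lift k (-f)) hw, hpo.exact_shortComplex.lift_f _ hw⟩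
  exact ⟨l, by simpa using hl =≫ biprod.snd⟩

/-- Over a left hereditary ring, submodules of projective modules are projective. -/
theorem projective_of_mono (hA : ∀ I : Submodule A A, Module.Projective A ↥I)
    {P Q : ModuleCat.{u} A} (j : P ⟶ Q) [Mono j] [Projective Q] : Projective P :=
  projective_of_mono_of_injective_of_epi (fun p ↦ injective_of_epi hA p) j

section Single

variable {C : Type u} [Category.{v} C] [Abelian C]

open HomologicalComplex

theorem isKProjective_single {P : C} [Projective P] :
    CochainComplex.IsKProjective ((single C (.up ℤ) 0).obj P) := by
  have (n : ℤ) : Projective (((single C (.up ℤ) 0).obj P).X n) := by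
    by_cases hn : n = 0
    · subst hn
      exact Projective.of_iso (singleObjXSelf (.up ℤ) 0 P).symm inferInstance
    · exact (isZero_single_obj_X (.up ℤ) 0 P n hn).projective
  exact CochainComplex.isKProjective_of_projective _ 0

theorem isKInjective_single {E : C} [Injective E] :
    CochainComplex.IsKInjective ((single C (.up ℤ) 0).obj E) := by
  have (n : ℤ) : Injective (((single C (.up ℤ) 0).obj E).X n) := by
    by_cases hn : n = 0
    · subst hn
      exact Injective.of_iso (singleObjXSelf (.up ℤ) 0 E).symm inferInstance
    · exact (isZero_single_obj_X (.up ℤ) 0 E n hn).injective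
  exact CochainComplex.isKInjective_of_injective _ 0

end Single

section Homology

variable {C : Type u} [Category.{v} C] [Abelian C] [HasDerivedCategory.{w} C]

open CochainComplex.HomComplex HomologicalComplex

/-- The cohomology of a complex seen in the derived category is the cohomology of the complex. -/
noncomputable def homologyQIso (K : CochainComplex C ℤ) (n : ℤ) :
    (homologyFunctor C n).obj (Q.obj K) ≅ K.homology n :=
  (homologyFunctorFactors C n).app K

theorem homologyFunctor_map_Q_map {K L : CochainComplex C ℤ} (g : K ⟶ L) (n : ℤ) :
    (homologyFunctor C n).map (Q.map g) = (homologyQIso K n).hom ≫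
      homologyMap g n ≫ (homologyQIso L n).inv := by
  rw [← Category.assoc, Iso.eq_comp_inv]
  exact homologyFunctorFactors_hom_naturality g n

/-- The cohomology in degree `0` of a stalk complex in degree `0`. -/
noncomputable def homologyStalkIso (M : C) :
    (homologyFunctor C 0).obj (Q.obj ((single C (.up ℤ) 0).obj M)) ≅ M :=
  homologyQIso _ 0 ≪≫ singleObjHomologySelfIso (.up ℤ) 0 M

theorem homologyStalkIso_hom (M : C) :
    (homologyStalkIso M).hom = (homologyQIso ((single C (.up ℤ) 0).obj M) 0).hom ≫
      (singleObjHomologySelfIso (.up ℤ) 0 M).hom :=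
  rfl

theorem homologyStalkIso_hom_naturality {M N : C} (f : M ⟶ N) :
    (homologyFunctor C 0).map (Q.map ((single C (.up ℤ) 0).map f)) ≫ (homologyStalkIso N).hom =
      (homologyStalkIso M).hom ≫ f := by
  simp only [homologyFunctor_map_Q_map, homologyStalkIso_hom, Category.assoc,
    Iso.inv_hom_id_assoc]
  rw [singleObjHomologySelfIso_hom_naturality]

theorem exists_homologyFunctor_map_eq_of_projective {P : C} [Projective P]
    (K : CochainComplex C ℤ) (φ : P ⟶ (homologyFunctor C 0).obj (Q.obj K)) :
    ∃ f : Q.obj ((single C (.up ℤ) 0).obj P) ⟶ Q.obj K,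
      (homologyFunctor C 0).map f = (homologyStalkIso P).hom ≫ φ := by
  let ψ : P ⟶ K.cycles 0 :=
    Projective.factorThru (φ ≫ (homologyQIso K 0).hom) (K.homologyπ 0)
  have hψ : ψ ≫ K.homologyπ 0 = φ ≫ (homologyQIso K 0).hom := by simp [ψ]
  let g : (single C (.up ℤ) 0).obj P ⟶ K := mkHomFromSingle (ψ ≫ K.iCycles 0) (by simp)
  have hg : cyclesMap g 0 = (singleObjCyclesSelfIso (.up ℤ) 0 P).hom ≫ ψ := by
    simp [← cancel_mono (K.iCycles 0), g, singleObjCyclesSelfIso_hom]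
  have hg' : homologyMap g 0 = (singleObjHomologySelfIso (.up ℤ) 0 P).hom ≫ φ ≫
      (homologyQIso K 0).hom := by
    rw [← cancel_epi (homologyπ _ 0), homologyπ_naturality, hg, Category.assoc, hψ]
    simp
  refine ⟨Q.map g, ?_⟩
  rw [homologyFunctor_map_Q_map, hg']
  simp [homologyStalkIso_hom]

theorem exists_homologyFunctor_map_eq_of_injective {E : C} [Injective E]
    (K : CochainComplex C ℤ) (φ : (homologyFunctor C 0).obj (Q.obj K) ⟶ E) :
    ∃ f : Q.obj K ⟶ Q.obj ((single C (.up ℤ) 0).obj E),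
      (homologyFunctor C 0).map f ≫ (homologyStalkIso E).hom = φ := by
  let ψ : K.opcycles 0 ⟶ E :=
    Injective.factorThru ((homologyQIso K 0).inv ≫ φ) (K.homologyι 0)
  have hψ : K.homologyι 0 ≫ ψ = (homologyQIso K 0).inv ≫ φ := by simp [ψ]
  let g : K ⟶ (single C (.up ℤ) 0).obj E := mkHomToSingle (K.pOpcycles 0 ≫ ψ) (by simp)
  have hg : opcyclesMap g 0 = ψ ≫ (singleObjOpcyclesSelfIso (.up ℤ) 0 E).hom := by
    simp [← cancel_epi (K.pOpcycles 0), g, singleObjOpcyclesSelfIso_hom]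
  have hg' : homologyMap g 0 = (homologyQIso K 0).inv ≫ φ ≫
      (singleObjHomologySelfIso (.up ℤ) 0 E).inv := by
    rw [← cancel_mono (homologyι _ 0), homologyι_naturality, hg, reassoc_of% hψ]
    simp
  refine ⟨Q.map g, ?_⟩
  rw [homologyFunctor_map_Q_map, hg']
  simp only [homologyStalkIso_hom, Category.assoc, Iso.hom_inv_id_assoc]
  erw [Iso.inv_hom_id_assoc, Iso.inv_hom_id, Category.comp_id]

theorem exists_Q_map_eq_of_isKProjective (P K : CochainComplex C ℤ) [P.IsKProjective]
    (f : Q.obj P ⟶ Q.obj K) : ∃ g : P ⟶ K, Q.map g = f := by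
  obtain ⟨g, hg⟩ := (CochainComplex.IsKProjective.Qh_map_bijective P
    ((HomotopyCategory.quotient _ _).obj K)).2
    ((quotientCompQhIso C).hom.app _ ≫ f ≫ (quotientCompQhIso C).inv.app K)
  obtain ⟨g, rfl⟩ := (HomotopyCategory.quotient _ _).map_surjective g
  refine ⟨g, ?_⟩
  have h := quotientCompQhIso_hom_naturality g
  rw [← cancel_epi ((quotientCompQhIso C).hom.app _), ← h, hg]
  simp

theorem exists_Q_map_eq_of_isKInjective (K E : CochainComplex C ℤ) [E.IsKInjective]
    (f : Q.obj K ⟶ Q.obj E) : ∃ g : K ⟶ E, Q.map g = f := by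
  obtain ⟨g, hg⟩ := (CochainComplex.IsKInjective.Qh_map_bijective
    ((HomotopyCategory.quotient _ _).obj K) E).2
    ((quotientCompQhIso C).hom.app _ ≫ f ≫ (quotientCompQhIso C).inv.app _)
  obtain ⟨g, rfl⟩ := (HomotopyCategory.quotient _ _).map_surjective g
  refine ⟨g, ?_⟩
  have h := quotientCompQhIso_hom_naturality g
  rw [← cancel_epi ((quotientCompQhIso C).hom.app _), ← h, hg]
  simp

theorem homologyMap_eq_zero_of_homologyFunctor_map_Q_map_eq_zero {K L : CochainComplex C ℤ}
    (g : K ⟶ L) (n : ℤ) (hg : (homologyFunctor C n).map (Q.map g) = 0) : homologyMap g n = 0 := by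
  simpa [homologyFunctor_map_Q_map] using hg

/-- A morphism from a stalk complex whose component factors through the differential
is null-homotopic. -/
noncomputable def homotopyZeroFromSingle {P : C} {K : CochainComplex C ℤ}
    (g : (CochainComplex.singleFunctor C 0).obj P ⟶ K) (b : P ⟶ K.X (-1))
    (hb : b ≫ K.d (-1) 0 = (singleObjXSelf (.up ℤ) 0 P).inv ≫ g.f 0) : Homotopy g 0 :=
  (Cochain.equivHomotopy g 0).symm ⟨Cochain.fromSingleMk b (zero_add (-1)), by
    rw [Cochain.δ_fromSingleMk _ _ 0 0 (zero_add 0), Cochain.ofHom_zero, add_zero, hb]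
    apply (Cochain.fromSingleEquiv (zero_add 0)).injective
    rw [Cochain.fromSingleEquiv_fromSingleMk]
    change _ ≫ (Cochain.ofHom g).v 0 0 _ = _
    rw [Cochain.ofHom_v]
    rfl⟩

/-- A morphism to a stalk complex whose component factors through the differential
is null-homotopic. -/
noncomputable def homotopyZeroToSingle {E : C} {K : CochainComplex C ℤ}
    (g : K ⟶ (CochainComplex.singleFunctor C 0).obj E) (b : K.X 1 ⟶ E)
    (hb : K.d 0 1 ≫ b = g.f 0 ≫ (singleObjXSelf (.up ℤ) 0 E).hom) : Homotopy g 0 :=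
  (Cochain.equivHomotopy g 0).symm ⟨Cochain.toSingleMk b (add_neg_cancel 1), by
    rw [Cochain.δ_toSingleMk _ _ 0 0 (zero_add 0), Cochain.ofHom_zero, add_zero, hb,
      Int.negOnePow_zero, one_smul]
    apply (Cochain.toSingleEquiv (zero_add 0)).injective
    rw [Cochain.toSingleEquiv_toSingleMk]
    change (Cochain.ofHom g).v 0 0 _ ≫ _ = _
    rw [Cochain.ofHom_v]⟩

theorem eq_zero_of_homologyFunctor_map_eq_zero_of_projective {P : C} [Projective P]
    (K : CochainComplex C ℤ) (f : Q.obj ((single C (.up ℤ) 0).obj P) ⟶ Q.obj K)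
    (hf : (homologyFunctor C 0).map f = 0) : f = 0 := by
  have := isKProjective_single (P := P)
  obtain ⟨g, rfl⟩ := exists_Q_map_eq_of_isKProjective _ _ f
  have hg : homologyMap g 0 = 0 :=
    homologyMap_eq_zero_of_homologyFunctor_map_Q_map_eq_zero g 0 hf
  let ψ : P ⟶ K.cycles 0 := (singleObjCyclesSelfIso (.up ℤ) 0 P).inv ≫ cyclesMap g 0
  have hψ : ψ ≫ K.homologyπ 0 = 0 := by
    simp [ψ, ← homologyπ_naturality, hg]
  have hex : (ShortComplex.mk _ _ (K.toCycles_comp_homologyπ (-1) 0)).Exact :=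
    ShortComplex.exact_of_g_is_cokernel _ (K.homologyIsCokernel (-1) 0 (by simp))
  let b : P ⟶ K.X (-1) := hex.liftFromProjective ψ hψ
  have hb : b ≫ K.toCycles (-1) 0 = ψ := hex.liftFromProjective_comp ψ hψ
  have hb' : b ≫ K.d (-1) 0 = (singleObjXSelf (.up ℤ) 0 P).inv ≫ g.f 0 := by
    rw [← K.toCycles_i (-1) 0, reassoc_of% hb]
    simp [ψ]
  exact (Q_map_eq_of_homotopy C (homotopyZeroFromSingle g b hb')).trans (Q.map_zero _ _)

theorem eq_zero_of_homologyFunctor_map_eq_zero_of_injective {E : C} [Injective E]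
    (K : CochainComplex C ℤ) (f : Q.obj K ⟶ Q.obj ((single C (.up ℤ) 0).obj E))
    (hf : (homologyFunctor C 0).map f = 0) : f = 0 := by
  have := isKInjective_single (E := E)
  obtain ⟨g, rfl⟩ := exists_Q_map_eq_of_isKInjective _ _ f
  have hg : homologyMap g 0 = 0 :=
    homologyMap_eq_zero_of_homologyFunctor_map_Q_map_eq_zero g 0 hf
  let ψ : K.opcycles 0 ⟶ E := opcyclesMap g 0 ≫ (singleObjOpcyclesSelfIso (.up ℤ) 0 E).inv
  have hψ : K.homologyι 0 ≫ ψ = 0 := by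
    simp [ψ, ← homologyι_naturality_assoc, hg]
  have hex : (ShortComplex.mk _ _ (K.homologyι_comp_fromOpcycles 0 1)).Exact :=
    ShortComplex.exact_of_f_is_kernel _ (K.homologyIsKernel 0 1 (by simp))
  let b : K.X 1 ⟶ E := hex.descToInjective ψ hψ
  have hb : K.fromOpcycles 0 1 ≫ b = ψ := hex.comp_descToInjective ψ hψ
  have hb' : K.d 0 1 ≫ b = g.f 0 ≫ (singleObjXSelf (.up ℤ) 0 E).hom := by
    rw [← K.p_fromOpcycles 0 1, Category.assoc, hb]
    simp [ψ]
  exact (Q_map_eq_of_homotopy C (homotopyZeroToSingle g b hb')).trans (Q.map_zero _ _)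

theorem stalk_triangle_distinguished {S : ShortComplex C} (hS : S.ShortExact) :
    ∃ δ, Triangle.mk (Q.map ((single C (.up ℤ) 0).map S.f))
      (Q.map ((single C (.up ℤ) 0).map S.g)) δ ∈ distTriang (DerivedCategory C) :=
  ⟨_, triangleOfSES_distinguished (hS.map_of_exact (single C (.up ℤ) 0))⟩

/-- If subobjects of projective objects are projective, the cohomology of a complex maps to
the complex in the derived category. -/
theorem exists_homologyFunctor_map_eq_homologyStalkIso_hom [EnoughProjectives C]
    (hC : ∀ {P P' : C} (j : P ⟶ P') [Mono j] [Projective P'], Projective P)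
    (K : CochainComplex C ℤ) :
    ∃ i : Q.obj ((single C (.up ℤ) 0).obj ((homologyFunctor C 0).obj (Q.obj K))) ⟶ Q.obj K,
      (homologyFunctor C 0).map i = (homologyStalkIso _).hom := by
  let p := Projective.π ((homologyFunctor C 0).obj (Q.obj K))
  have : Projective (Projective.over ((homologyFunctor C 0).obj (Q.obj K))) :=
    Projective.projective_over _
  have hk : Projective (kernel p) := hC (kernel.ι p)
  have hS : (ShortComplex.mk (kernel.ι p) p (kernel.condition p)).ShortExact :=
    { exact := ShortComplex.exact_of_f_is_kernel _ (kernelIsKernel p)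
      mono_f := inferInstanceAs (Mono (kernel.ι p))
      epi_g := inferInstanceAs (Epi p) }
  obtain ⟨f, hf⟩ := exists_homologyFunctor_map_eq_of_projective K p
  obtain ⟨δ, hδ⟩ := stalk_triangle_distinguished hS
  have h0 : Q.map ((single C (.up ℤ) 0).map (kernel.ι p)) ≫ f = 0 := by
    apply eq_zero_of_homologyFunctor_map_eq_zero_of_projective
    rw [Functor.map_comp, hf, ← Category.assoc, homologyStalkIso_hom_naturality,
      Category.assoc, kernel.condition, comp_zero]
  obtain ⟨i, hi⟩ : ∃ i : Q.obj ((single C (.up ℤ) 0).obj ((homologyFunctor C 0).obj (Q.obj K))) ⟶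
      Q.obj K, f = Q.map ((single C (.up ℤ) 0).map p) ≫ i :=
    Triangle.yoneda_exact₂ _ hδ f h0
  refine ⟨i, ?_⟩
  have he : Epi ((homologyFunctor C 0).map (Q.map ((single C (.up ℤ) 0).map p))) := by
    have h : (homologyFunctor C 0).map (Q.map ((single C (.up ℤ) 0).map p)) =
        (homologyStalkIso _).hom ≫ p ≫ (homologyStalkIso _).inv := by
      rw [← Category.assoc, Iso.eq_comp_inv, homologyStalkIso_hom_naturality]
    rw [h]
    infer_instance
  rw [← cancel_epi ((homologyFunctor C 0).map (Q.map ((single C (.up ℤ) 0).map p))),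
    homologyStalkIso_hom_naturality, ← hf, ← Functor.map_comp, hi]

/-- If quotients of injective objects are injective, a complex maps to its cohomology in
the derived category. -/
theorem exists_homologyFunctor_map_comp_homologyStalkIso_hom_eq_id [EnoughInjectives C]
    (hC : ∀ {E F : C} (p : E ⟶ F) [Epi p] [Injective E], Injective F)
    (K : CochainComplex C ℤ) :
    ∃ r : Q.obj K ⟶ Q.obj ((single C (.up ℤ) 0).obj ((homologyFunctor C 0).obj (Q.obj K))),
      (homologyFunctor C 0).map r ≫ (homologyStalkIso _).hom = 𝟙 _ := by
  let j := Injective.ι ((homologyFunctor C 0).obj (Q.obj K))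
  have : Injective (Injective.under ((homologyFunctor C 0).obj (Q.obj K))) :=
    Injective.injective_under _
  have hk : Injective (cokernel j) := hC (cokernel.π j)
  have hS : (ShortComplex.mk j (cokernel.π j) (cokernel.condition j)).ShortExact :=
    { exact := ShortComplex.exact_of_g_is_cokernel _ (cokernelIsCokernel j)
      mono_f := inferInstanceAs (Mono j)
      epi_g := inferInstanceAs (Epi (cokernel.π j)) }
  obtain ⟨f, hf⟩ := exists_homologyFunctor_map_eq_of_injective K j
  obtain ⟨δ, hδ⟩ := stalk_triangle_distinguished hS
  have h0 : f ≫ Q.map ((single C (.up ℤ) 0).map (cokernel.π j)) = 0 := by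
    apply eq_zero_of_homologyFunctor_map_eq_zero_of_injective
    rw [← cancel_mono (homologyStalkIso _).hom, Functor.map_comp, Category.assoc,
      homologyStalkIso_hom_naturality, reassoc_of% hf, cokernel.condition, zero_comp]
  obtain ⟨r, hr⟩ : ∃ r : Q.obj K ⟶
      Q.obj ((single C (.up ℤ) 0).obj ((homologyFunctor C 0).obj (Q.obj K))),
      f = r ≫ Q.map ((single C (.up ℤ) 0).map j) :=
    Triangle.coyoneda_exact₂ _ hδ f h0
  refine ⟨r, ?_⟩
  rw [← cancel_mono j, Category.assoc, ← homologyStalkIso_hom_naturality,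
    ← Functor.map_comp_assoc, ← hr, hf, Category.id_comp]

theorem eq_id_of_homologyFunctor_map_eq_id {M : C}
    (f : Q.obj ((single C (.up ℤ) 0).obj M) ⟶ Q.obj ((single C (.up ℤ) 0).obj M))
    (hf : (homologyFunctor C 0).map f = 𝟙 _) : f = 𝟙 _ := by
  obtain ⟨g, rfl⟩ : ∃ g : M ⟶ M, Q.map ((single C (.up ℤ) 0).map g) = f :=
    (singleFunctor C 0).map_surjective (X := M) (Y := M) f
  have h := homologyStalkIso_hom_naturality g
  rw [hf, Category.id_comp, eq_comm] at h
  obtain rfl : g = 𝟙 M := (cancel_epi (homologyStalkIso M).hom).1 (by rw [h, Category.comp_id])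
  simp

theorem exists_retract_homology [EnoughProjectives C] [EnoughInjectives C]
    (hP : ∀ {P P' : C} (j : P ⟶ P') [Mono j] [Projective P'], Projective P)
    (hI : ∀ {E F : C} (p : E ⟶ F) [Epi p] [Injective E], Injective F)
    (X : DerivedCategory C) :
    Nonempty (Retract ((singleFunctor C 0).obj ((homologyFunctor C 0).obj X)) X) := by
  suffices h : ∀ (K : CochainComplex C ℤ),
      Nonempty (Retract ((singleFunctor C 0).obj ((homologyFunctor C 0).obj (Q.obj K)))
        (Q.obj K)) by
    obtain ⟨h⟩ := h (Q.objPreimage X)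
    let e := Q.objObjPreimageIso X
    exact ⟨(Retract.ofIso ((singleFunctor C 0).mapIso
      ((homologyFunctor C 0).mapIso e.symm))).trans (h.trans (Retract.ofIso e))⟩
  intro K
  obtain ⟨i, hi⟩ := exists_homologyFunctor_map_eq_homologyStalkIso_hom hP K
  obtain ⟨r, hr⟩ := exists_homologyFunctor_map_comp_homologyStalkIso_hom_eq_id hI K
  refine ⟨{ i := i, r := r, retract := ?_ }⟩
  have h : (homologyFunctor C 0).map i ≫ (homologyFunctor C 0).map r = 𝟙 _ := by
    rw [← cancel_mono (homologyStalkIso _).hom, Category.assoc, hr, hi]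
    simp
  exact eq_id_of_homologyFunctor_map_eq_id (i ≫ r) (((homologyFunctor C 0).map_comp i r).trans h)

end Homology

section Families

variable {C : Type u} [Category.{v} C] [Abelian C] {J : Type*}

/-- A family of complexes, seen as a complex of families. -/
@[simps]
def familyComplex (K : J → CochainComplex C ℤ) : CochainComplex (Discrete J ⥤ C) ℤ where
  X n := Discrete.functor fun j ↦ (K j).X n
  d n m := Discrete.natTrans fun j ↦ (K j.as).d n m
  shape n m h := by ext ⟨j⟩; exact (K j).shape n m h
  d_comp_d' n m k _ _ := by ext ⟨j⟩; exact (K j).d_comp_d n m k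

/-- A family of morphisms of complexes, seen as a morphism of complexes of families. -/
@[simps]
def familyMap {K L : J → CochainComplex C ℤ} (s : ∀ j, K j ⟶ L j) :
    familyComplex K ⟶ familyComplex L where
  f n := Discrete.natTrans fun j ↦ (s j.as).f n
  comm' n m _ := by ext ⟨j⟩; exact (s j).comm n m

theorem quasiIso_familyMap {K L : J → CochainComplex C ℤ} (s : ∀ j, K j ⟶ L j)
    [hs : ∀ j, QuasiIso (s j)] : QuasiIso (familyMap s) := by
  rw [quasiIso_iff]
  intro n
  rw [quasiIsoAt_iff_isIso_homologyMap, NatTrans.isIso_iff_isIso_app]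
  intro j
  let F := (evaluation (Discrete J) C).obj j
  let φ := (HomologicalComplex.shortComplexFunctor _ (.up ℤ) n).map (familyMap s)
  have h : IsIso (F.map (ShortComplex.homologyMap φ)) := by
    have h₁ : IsIso (ShortComplex.homologyMap (F.mapShortComplex.map φ)) :=
      (quasiIsoAt_iff_isIso_homologyMap (s j.as) n).1 ((hs j.as).quasiIsoAt n)
    have h₂ : F.map (ShortComplex.homologyMap φ) = (ShortComplex.mapHomologyIso _ F).inv ≫
        ShortComplex.homologyMap (F.mapShortComplex.map φ) ≫
          (ShortComplex.mapHomologyIso _ F).hom := by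
      rw [Iso.eq_inv_comp]
      exact (ShortComplex.mapHomologyIso_hom_naturality φ F).symm
    rw [h₂]
    exact @IsIso.comp_isIso _ _ _ _ _ _ _ (Iso.isIso_inv _)
      (@IsIso.comp_isIso _ _ _ _ _ _ _ h₁ (Iso.isIso_hom _))
  exact h

section Fractions

variable [HasDerivedCategory.{w} C]

theorem Qh_map_quotient_map_eq_zero {K L : CochainComplex C ℤ} {f : K ⟶ L} (hf : Q.map f = 0) :
    Qh.map ((HomotopyCategory.quotient C (.up ℤ)).map f) =
      Qh.map ((HomotopyCategory.quotient C (.up ℤ)).map 0) := by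
  have h : (HomotopyCategory.quotient C (.up ℤ) ⋙ Qh).map f =
      (HomotopyCategory.quotient C (.up ℤ) ⋙ Qh).map 0 := by
    rw [← cancel_mono ((quotientCompQhIso C).hom.app L), (quotientCompQhIso C).hom.naturality,
      (quotientCompQhIso C).hom.naturality, hf, Q.map_zero]
  exact h

theorem exists_quasiIso_comp_homotopy_zero {K L : CochainComplex C ℤ} (f : K ⟶ L)
    (hf : Q.map f = 0) : ∃ (K' : CochainComplex C ℤ) (s : K' ⟶ K), QuasiIso s ∧
      Nonempty (Homotopy (s ≫ f) 0) := by
  obtain ⟨K', s, hs, fac⟩ := (MorphismProperty.map_eq_iff_precomp Qh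
    (HomotopyCategory.quasiIso C (.up ℤ)) _ _).1 (Qh_map_quotient_map_eq_zero hf)
  obtain ⟨K', rfl⟩ := HomotopyCategory.quotient_obj_surjective K'
  obtain ⟨s, rfl⟩ := (HomotopyCategory.quotient _ _).map_surjective s
  refine ⟨K', s, (HomotopyCategory.quotient_map_mem_quasiIso_iff _).1 hs,
    ⟨HomotopyCategory.homotopyOfEq _ _ ?_⟩⟩
  rw [Functor.map_comp, ← comp_zero (f := s), Functor.map_comp]
  exact fac

theorem exists_comp_quasiIso_homotopy_zero {K L : CochainComplex C ℤ} (f : K ⟶ L)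
    (hf : Q.map f = 0) : ∃ (L' : CochainComplex C ℤ) (s : L ⟶ L'), QuasiIso s ∧
      Nonempty (Homotopy (f ≫ s) 0) := by
  obtain ⟨L', s, hs, fac⟩ := (MorphismProperty.map_eq_iff_postcomp Qh
    (HomotopyCategory.quasiIso C (.up ℤ)) _ _).1 (Qh_map_quotient_map_eq_zero hf)
  obtain ⟨L', rfl⟩ := HomotopyCategory.quotient_obj_surjective L'
  obtain ⟨s, rfl⟩ := (HomotopyCategory.quotient _ _).map_surjective s
  refine ⟨L', s, (HomotopyCategory.quotient_map_mem_quasiIso_iff _).1 hs,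
    ⟨HomotopyCategory.homotopyOfEq _ _ ?_⟩⟩
  rw [Functor.map_comp, ← zero_comp (f := s), Functor.map_comp]
  exact fac

end Fractions

section Sigma

variable [HasCoproductsOfShape J C]

/-- The degreewise coproduct of a family of complexes. -/
noncomputable abbrev sigmaComplex (K : J → CochainComplex C ℤ) : CochainComplex C ℤ :=
  (colim.mapHomologicalComplex _).obj (familyComplex K)

/-- The inclusions in the degreewise coproduct. -/
noncomputable def sigmaι (K : J → CochainComplex C ℤ) (j : J) : K j ⟶ sigmaComplex K where
  f n := Sigma.ι (fun j ↦ (K j).X n) j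
  comm' n m _ := ι_colimMap ((familyComplex K).d n m) ⟨j⟩

theorem sigmaComplex_hom_ext {K : J → CochainComplex C ℤ} {n : ℤ} {Y : C}
    {f g : (sigmaComplex K).X n ⟶ Y} (h : ∀ j, (sigmaι K j).f n ≫ f = (sigmaι K j).f n ≫ g) :
    f = g :=
  Sigma.hom_ext _ _ h

/-- The morphism out of a term of the degreewise coproduct given by a family of morphisms. -/
noncomputable def sigmaDescX {K : J → CochainComplex C ℤ} {n : ℤ} {Y : C}
    (f : ∀ j, (K j).X n ⟶ Y) : (sigmaComplex K).X n ⟶ Y :=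
  Sigma.desc f

theorem sigmaι_sigmaDescX {K : J → CochainComplex C ℤ} {n : ℤ} {Y : C}
    (f : ∀ j, (K j).X n ⟶ Y) (j : J) : (sigmaι K j).f n ≫ sigmaDescX f = f j :=
  Sigma.ι_desc _ _

/-- The morphism out of the degreewise coproduct given by a family of morphisms. -/
noncomputable def sigmaDesc {K : J → CochainComplex C ℤ} {L : CochainComplex C ℤ}
    (f : ∀ j, K j ⟶ L) : sigmaComplex K ⟶ L where
  f n := sigmaDescX fun j ↦ (f j).f n
  comm' n m _ := sigmaComplex_hom_ext fun j ↦ by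
    rw [← Category.assoc, ← Category.assoc, sigmaι_sigmaDescX, (sigmaι K j).comm,
      Category.assoc, sigmaι_sigmaDescX, (f j).comm]

theorem sigmaι_sigmaDesc {K : J → CochainComplex C ℤ} {L : CochainComplex C ℤ}
    (f : ∀ j, K j ⟶ L) (j : J) : sigmaι K j ≫ sigmaDesc f = f j := by
  ext n
  exact sigmaι_sigmaDescX _ _

/-- The functoriality of the degreewise coproduct. -/
noncomputable def sigmaMap {K L : J → CochainComplex C ℤ} (s : ∀ j, K j ⟶ L j) :
    sigmaComplex K ⟶ sigmaComplex L :=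
  (colim.mapHomologicalComplex _).map (familyMap s)

theorem sigmaι_sigmaMap {K L : J → CochainComplex C ℤ} (s : ∀ j, K j ⟶ L j) (j : J) :
    sigmaι K j ≫ sigmaMap s = s j ≫ sigmaι L j := by
  ext n
  exact ι_colimMap ((familyMap s).f n) ⟨j⟩

theorem quasiIso_sigmaMap [HasExactColimitsOfShape (Discrete J) C]
    {K L : J → CochainComplex C ℤ} (s : ∀ j, K j ⟶ L j) [∀ j, QuasiIso (s j)] :
    QuasiIso (sigmaMap s) := by
  have := quasiIso_familyMap s
  have : (colim : (Discrete J ⥤ C) ⥤ C).PreservesHomology := inferInstance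
  exact HomologicalComplex.quasiIso_map_of_preservesHomology (familyMap s) colim

/-- A morphism from a degreewise coproduct is null-homotopic if its components are. -/
noncomputable def sigmaHomotopy {K : J → CochainComplex C ℤ} {L : CochainComplex C ℤ}
    (f : sigmaComplex K ⟶ L) (H : ∀ j, Homotopy (sigmaι K j ≫ f) 0) : Homotopy f 0 where
  hom n m := sigmaDescX fun j ↦ (H j).hom n m
  zero n m h := sigmaComplex_hom_ext fun j ↦ by
    rw [sigmaι_sigmaDescX, (H j).zero n m h, comp_zero]
  comm n := sigmaComplex_hom_ext fun j ↦ by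
    have h : (H j).hom = fun n m ↦ (sigmaι K j).f n ≫ sigmaDescX fun j ↦ (H j).hom n m := by
      ext n m
      rw [sigmaι_sigmaDescX]
    have := (H j).comm n
    rw [h, dNext_comp_left, prevD_comp_left] at this
    simpa using this

variable [HasDerivedCategory.{w} C] [HasExactColimitsOfShape (Discrete J) C]

theorem eq_zero_of_Q_map_sigmaι_comp {K : J → CochainComplex C ℤ}
    {L : CochainComplex C ℤ} (h : Q.obj (sigmaComplex K) ⟶ Q.obj L)
    (hh : ∀ j, Q.map (sigmaι K j) ≫ h = 0) : h = 0 := by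
  obtain ⟨L', f, s, hs, rfl⟩ := left_fac h
  have hf (j : J) : Q.map (sigmaι K j ≫ f) = 0 := by
    have := hh j
    rw [← Category.assoc, ← Q.map_comp] at this
    rw [← cancel_mono (inv (Q.map s)), this, zero_comp]
  choose K' t ht H using fun j ↦ exists_quasiIso_comp_homotopy_zero _ (hf j)
  have H' := sigmaHomotopy (sigmaMap t ≫ f) (K := K') fun j ↦
    (Homotopy.ofEq (by rw [← Category.assoc, ← Category.assoc, sigmaι_sigmaMap])).trans (H j).some
  have h₁ : Q.map (sigmaMap t) ≫ Q.map f = 0 := by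
    rw [← Q.map_comp, Q_map_eq_of_homotopy C H', Q.map_zero]
  have h₂ : IsIso (Q.map (sigmaMap t)) := (isIso_Q_map_iff_quasiIso C _).2 (quasiIso_sigmaMap t)
  rw [← cancel_epi (Q.map (sigmaMap t)), ← Category.assoc, h₁, zero_comp, comp_zero]

theorem exists_Q_map_sigmaι_comp {K : J → CochainComplex C ℤ}
    {L : CochainComplex C ℤ} (f : ∀ j, Q.obj (K j) ⟶ Q.obj L) :
    ∃ h : Q.obj (sigmaComplex K) ⟶ Q.obj L, ∀ j, Q.map (sigmaι K j) ≫ h = f j := by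
  choose K' s hs g fac using fun j ↦ right_fac (f j)
  have (j : J) : QuasiIso (s j) := (isIso_Q_map_iff_quasiIso C _).1 (hs j)
  have := (isIso_Q_map_iff_quasiIso C _).2 (quasiIso_sigmaMap s)
  refine ⟨inv (Q.map (sigmaMap s)) ≫ Q.map (sigmaDesc g), fun j ↦ ?_⟩
  rw [fac j, ← cancel_epi (Q.map (s j)), IsIso.hom_inv_id_assoc, ← Category.assoc, ← Q.map_comp,
    ← sigmaι_sigmaMap, Q.map_comp, Category.assoc, IsIso.hom_inv_id_assoc, ← Q.map_comp,
    sigmaι_sigmaDesc]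

/-- The derived category has coproducts indexed by `J` if coproducts indexed by `J` are exact. -/
theorem exists_isColimit_cofan
    (X : J → DerivedCategory C) : ∃ c : Cofan X, Nonempty (IsColimit c) := by
  let K (j : J) := Q.objPreimage (X j)
  let e (j : J) : Q.obj (K j) ≅ X j := Q.objObjPreimageIso (X j)
  have hd {Y : DerivedCategory C} (f : ∀ j, X j ⟶ Y) :
      ∃ h : Q.obj (sigmaComplex K) ⟶ Y, ∀ j, (e j).inv ≫ Q.map (sigmaι K j) ≫ h = f j := by
    obtain ⟨h, hh⟩ := exists_Q_map_sigmaι_comp fun j ↦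
      (e j).hom ≫ f j ≫ (Q.objObjPreimageIso Y).inv
    refine ⟨h ≫ (Q.objObjPreimageIso Y).hom, fun j ↦ ?_⟩
    rw [reassoc_of% hh j]
    simp
  have hext {Y : DerivedCategory C} {f g : Q.obj (sigmaComplex K) ⟶ Y}
      (h : ∀ j, (e j).inv ≫ Q.map (sigmaι K j) ≫ f = (e j).inv ≫ Q.map (sigmaι K j) ≫ g) :
      f = g := by
    rw [← sub_eq_zero, ← cancel_mono (Q.objObjPreimageIso Y).inv, zero_comp]
    refine eq_zero_of_Q_map_sigmaι_comp _ fun j ↦ ?_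
    have := h j
    rw [cancel_epi] at this
    rw [← Category.assoc, Preadditive.comp_sub, this, sub_self, zero_comp]
  choose d hd using @hd
  exact ⟨Cofan.mk (Q.obj (sigmaComplex K)) fun j ↦ (e j).inv ≫ Q.map (sigmaι K j),
    ⟨Cofan.IsColimit.mk _ (fun s ↦ d s.inj)
      (fun s j ↦ (Category.assoc _ _ _).trans (hd s.inj j))
      fun s m hm ↦ hext fun j ↦ ((Category.assoc _ _ _).symm.trans (hm j)).trans
        (hd s.inj j).symm⟩⟩

end Sigma

section Pi

variable [HasProductsOfShape J C]

/-- The degreewise product of a family of complexes. -/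
noncomputable abbrev piComplex (K : J → CochainComplex C ℤ) : CochainComplex C ℤ :=
  (lim.mapHomologicalComplex _).obj (familyComplex K)

/-- The projections of the degreewise product. -/
noncomputable def piπ (K : J → CochainComplex C ℤ) (j : J) : piComplex K ⟶ K j where
  f n := Pi.π (fun j ↦ (K j).X n) j
  comm' n m _ := (limMap_π ((familyComplex K).d n m) ⟨j⟩).symm

theorem piComplex_hom_ext {K : J → CochainComplex C ℤ} {n : ℤ} {Y : C}
    {f g : Y ⟶ (piComplex K).X n} (h : ∀ j, f ≫ (piπ K j).f n = g ≫ (piπ K j).f n) :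
    f = g :=
  Pi.hom_ext _ _ h

/-- The morphism to a term of the degreewise product given by a family of morphisms. -/
noncomputable def piLiftX {K : J → CochainComplex C ℤ} {n : ℤ} {Y : C}
    (f : ∀ j, Y ⟶ (K j).X n) : Y ⟶ (piComplex K).X n :=
  Pi.lift f

theorem piLiftX_piπ {K : J → CochainComplex C ℤ} {n : ℤ} {Y : C}
    (f : ∀ j, Y ⟶ (K j).X n) (j : J) : piLiftX f ≫ (piπ K j).f n = f j :=
  Pi.lift_π _ _

/-- The morphism to the degreewise product given by a family of morphisms. -/
noncomputable def piLift {K : J → CochainComplex C ℤ} {L : CochainComplex C ℤ}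
    (f : ∀ j, L ⟶ K j) : L ⟶ piComplex K where
  f n := piLiftX fun j ↦ (f j).f n
  comm' n m _ := piComplex_hom_ext fun j ↦ by
    rw [Category.assoc, Category.assoc, piLiftX_piπ, ← (piπ K j).comm,
      ← Category.assoc, piLiftX_piπ, (f j).comm]

theorem piLift_piπ {K : J → CochainComplex C ℤ} {L : CochainComplex C ℤ}
    (f : ∀ j, L ⟶ K j) (j : J) : piLift f ≫ piπ K j = f j := by
  ext n
  exact piLiftX_piπ _ _

/-- The functoriality of the degreewise product. -/
noncomputable def piMap {K L : J → CochainComplex C ℤ} (s : ∀ j, K j ⟶ L j) :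
    piComplex K ⟶ piComplex L :=
  (lim.mapHomologicalComplex _).map (familyMap s)

theorem piMap_piπ {K L : J → CochainComplex C ℤ} (s : ∀ j, K j ⟶ L j) (j : J) :
    piMap s ≫ piπ L j = piπ K j ≫ s j := by
  ext n
  exact limMap_π ((familyMap s).f n) ⟨j⟩

theorem quasiIso_piMap [HasExactLimitsOfShape (Discrete J) C]
    {K L : J → CochainComplex C ℤ} (s : ∀ j, K j ⟶ L j) [∀ j, QuasiIso (s j)] :
    QuasiIso (piMap s) := by
  have := quasiIso_familyMap s
  have : (Functor.const (Discrete J) : C ⥤ Discrete J ⥤ C).Additive := { map_add := rfl }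
  have : (lim : (Discrete J ⥤ C) ⥤ C).Additive :=
    constLimAdj.right_adjoint_additive
  have : (lim : (Discrete J ⥤ C) ⥤ C).PreservesHomology := inferInstance
  exact HomologicalComplex.quasiIso_map_of_preservesHomology (familyMap s) lim

/-- A morphism to a degreewise product is null-homotopic if its components are. -/
noncomputable def piHomotopy {K : J → CochainComplex C ℤ} {L : CochainComplex C ℤ}
    (f : L ⟶ piComplex K) (H : ∀ j, Homotopy (f ≫ piπ K j) 0) : Homotopy f 0 where
  hom n m := piLiftX fun j ↦ (H j).hom n m
  zero n m h := piComplex_hom_ext fun j ↦ by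
    rw [piLiftX_piπ, (H j).zero n m h, zero_comp]
  comm n := piComplex_hom_ext fun j ↦ by
    have h : (H j).hom = fun n m ↦ (piLiftX fun j ↦ (H j).hom n m) ≫ (piπ K j).f m := by
      ext n m
      rw [piLiftX_piπ]
    have := (H j).comm n
    rw [h, dNext_comp_right, prevD_comp_right] at this
    simpa using this

variable [HasDerivedCategory.{w} C] [HasExactLimitsOfShape (Discrete J) C]

theorem eq_zero_of_comp_Q_map_piπ {K : J → CochainComplex C ℤ}
    {L : CochainComplex C ℤ} (h : Q.obj L ⟶ Q.obj (piComplex K))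
    (hh : ∀ j, h ≫ Q.map (piπ K j) = 0) : h = 0 := by
  obtain ⟨L', s, hs, f, rfl⟩ := right_fac h
  have hf (j : J) : Q.map (f ≫ piπ K j) = 0 := by
    have := hh j
    rw [Category.assoc, ← Q.map_comp] at this
    rw [← cancel_epi (inv (Q.map s)), this, comp_zero]
  choose K' t ht H using fun j ↦ exists_comp_quasiIso_homotopy_zero _ (hf j)
  have H' := piHomotopy (f ≫ piMap t) (K := K') fun j ↦
    (Homotopy.ofEq (by rw [Category.assoc, Category.assoc, piMap_piπ])).trans (H j).some
  have h₁ : Q.map f ≫ Q.map (piMap t) = 0 := by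
    rw [← Q.map_comp, Q_map_eq_of_homotopy C H', Q.map_zero]
  have h₂ : IsIso (Q.map (piMap t)) := (isIso_Q_map_iff_quasiIso C _).2 (quasiIso_piMap t)
  rw [← cancel_mono (Q.map (piMap t)), Category.assoc, h₁, zero_comp, comp_zero]

theorem exists_comp_Q_map_piπ {K : J → CochainComplex C ℤ}
    {L : CochainComplex C ℤ} (f : ∀ j, Q.obj L ⟶ Q.obj (K j)) :
    ∃ h : Q.obj L ⟶ Q.obj (piComplex K), ∀ j, h ≫ Q.map (piπ K j) = f j := by
  choose K' g s hs fac using fun j ↦ left_fac (f j)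
  have (j : J) : QuasiIso (s j) := (isIso_Q_map_iff_quasiIso C _).1 (hs j)
  have := (isIso_Q_map_iff_quasiIso C _).2 (quasiIso_piMap s)
  refine ⟨Q.map (piLift g) ≫ inv (Q.map (piMap s)), fun j ↦ ?_⟩
  rw [fac j, ← cancel_mono (Q.map (s j)), Category.assoc, Category.assoc, Category.assoc,
    IsIso.inv_hom_id, Category.comp_id, ← Q.map_comp, ← piMap_piπ, Q.map_comp,
    IsIso.inv_hom_id_assoc, ← Q.map_comp, piLift_piπ]

/-- The derived category has products indexed by `J` if products indexed by `J` are exact. -/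
theorem exists_isLimit_fan (X : J → DerivedCategory C) :
    ∃ c : Fan X, Nonempty (IsLimit c) := by
  let K (j : J) := Q.objPreimage (X j)
  let e (j : J) : Q.obj (K j) ≅ X j := Q.objObjPreimageIso (X j)
  have hl {Y : DerivedCategory C} (f : ∀ j, Y ⟶ X j) :
      ∃ h : Y ⟶ Q.obj (piComplex K), ∀ j, h ≫ Q.map (piπ K j) ≫ (e j).hom = f j := by
    obtain ⟨h, hh⟩ := exists_comp_Q_map_piπ fun j ↦
      (Q.objObjPreimageIso Y).hom ≫ f j ≫ (e j).inv
    refine ⟨(Q.objObjPreimageIso Y).inv ≫ h, fun j ↦ ?_⟩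
    rw [Category.assoc, reassoc_of% hh j]
    simp
  have hext {Y : DerivedCategory C} {f g : Y ⟶ Q.obj (piComplex K)}
      (h : ∀ j, f ≫ Q.map (piπ K j) ≫ (e j).hom = g ≫ Q.map (piπ K j) ≫ (e j).hom) :
      f = g := by
    rw [← sub_eq_zero, ← cancel_epi (Q.objObjPreimageIso Y).hom, comp_zero]
    refine eq_zero_of_comp_Q_map_piπ _ fun j ↦ ?_
    have := h j
    rw [← Category.assoc, ← Category.assoc, cancel_mono] at this
    rw [Category.assoc, Preadditive.sub_comp, this, sub_self, comp_zero]
  choose l hl using @hl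
  exact ⟨Fan.mk (Q.obj (piComplex K)) fun j ↦ Q.map (piπ K j) ≫ (e j).hom,
    ⟨Fan.IsLimit.mk _ (fun s ↦ l s.proj) (fun s j ↦ hl s.proj j)
      fun s m hm ↦ hext fun j ↦ (hm j).trans (hl s.proj j).symm⟩⟩

end Pi

end Families

section Swindle

variable {D : Type*} [Category* D] [Preadditive D]

/-- A retraction datum `(φ, ψ, s, p)` exhibiting `Y` as the biproduct of itself and `M`. -/
theorem nonempty_iso_biprod [HasBinaryBiproducts D] {Y M : D} (φ ψ : Y ⟶ Y) (s : M ⟶ Y)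
    (p : Y ⟶ M) (hφψ : φ ≫ ψ = 𝟙 Y) (hφp : φ ≫ p = 0) (hsψ : s ≫ ψ = 0) (hsp : s ≫ p = 𝟙 M)
    (h : ψ ≫ φ + p ≫ s = 𝟙 Y) : Nonempty (Y ≅ Y ⊞ M) :=
  ⟨{ hom := biprod.lift ψ p
     inv := biprod.desc φ s
     hom_inv_id := by simp [h]
     inv_hom_id := by ext <;> simp [hφψ, hφp, hsψ, hsp] }⟩

/-- The Eilenberg swindle for coproducts. -/
theorem nonempty_iso_biprod_of_isColimit [HasBinaryBiproducts D] {X M : D} (h : Retract M X)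
    (c : Cofan fun _ : ULift.{w} ℕ ↦ X) (hc : IsColimit c) : Nonempty (c.pt ≅ c.pt ⊞ M) := by
  let ι (n : ℕ) : X ⟶ c.pt := c.inj ⟨n⟩
  let d {Z : D} (a : ℕ → (X ⟶ Z)) : c.pt ⟶ Z := Cofan.IsColimit.desc hc fun n ↦ a n.down
  have hd {Z : D} (a : ℕ → (X ⟶ Z)) (n : ℕ) : ι n ≫ d a = a n := Cofan.IsColimit.fac hc _ ⟨n⟩
  have hext {Z : D} (f g : c.pt ⟶ Z) (H : ∀ n, ι n ≫ f = ι n ≫ g) : f = g :=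
    Cofan.IsColimit.hom_ext hc _ _ fun n ↦ H n.down
  let a (n : ℕ) : X ⟶ c.pt := ι n - h.r ≫ h.i ≫ ι n + h.r ≫ h.i ≫ ι (n + 1)
  let φ : c.pt ⟶ c.pt := d a
  let b (n : ℕ) : X ⟶ c.pt := match n with
    | 0 => ι 0 - h.r ≫ h.i ≫ ι 0
    | n + 1 => ι (n + 1) - h.r ≫ h.i ≫ ι (n + 1) + h.r ≫ h.i ≫ ι n
  let ψ : c.pt ⟶ c.pt := d b
  let q (n : ℕ) : X ⟶ M := match n with
    | 0 => h.r
    | n + 1 => 0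
  let p : c.pt ⟶ M := d q
  have hφ (n : ℕ) : ι n ≫ φ = ι n - h.r ≫ h.i ≫ ι n + h.r ≫ h.i ≫ ι (n + 1) :=
    hd a n
  have hψ (n : ℕ) : ι (n + 1) ≫ ψ = ι (n + 1) - h.r ≫ h.i ≫ ι (n + 1) + h.r ≫ h.i ≫ ι n :=
    hd b (n + 1)
  have hψ₀ : ι 0 ≫ ψ = ι 0 - h.r ≫ h.i ≫ ι 0 := hd b 0
  have hp (n : ℕ) : ι (n + 1) ≫ p = 0 := hd q (n + 1)
  have hp₀ : ι 0 ≫ p = h.r := hd q 0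
  refine nonempty_iso_biprod φ ψ (h.i ≫ ι 0) p (hext _ _ fun n ↦ ?_) (hext _ _ fun n ↦ ?_) ?_ ?_
    (hext _ _ fun n ↦ ?_)
  · rcases n with - | n <;>
      simp [reassoc_of% hφ, hψ, hψ₀, Preadditive.add_comp, Preadditive.sub_comp]
  · rcases n with - | n <;>
      simp [reassoc_of% hφ, hp, hp₀, Preadditive.add_comp, Preadditive.sub_comp]
  · simp [hψ₀]
  · simp [hp₀]
  · rcases n with - | n <;>
      simp [reassoc_of% hψ, reassoc_of% hψ₀, reassoc_of% hp, reassoc_of% hp₀, hφ]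

/-- The Eilenberg swindle for products. -/
theorem nonempty_iso_biprod_of_isLimit [HasBinaryBiproducts D] {X M : D} (h : Retract M X)
    (c : Fan fun _ : ULift.{w} ℕ ↦ X) (hc : IsLimit c) : Nonempty (c.pt ≅ c.pt ⊞ M) := by
  let π (n : ℕ) : c.pt ⟶ X := c.proj ⟨n⟩
  let l {Z : D} (a : ℕ → (Z ⟶ X)) : Z ⟶ c.pt := Fan.IsLimit.lift hc fun n ↦ a n.down
  have hl {Z : D} (a : ℕ → (Z ⟶ X)) (n : ℕ) : l a ≫ π n = a n := Fan.IsLimit.fac hc _ ⟨n⟩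
  have hext {Z : D} (f g : Z ⟶ c.pt) (H : ∀ n, f ≫ π n = g ≫ π n) : f = g :=
    Fan.IsLimit.hom_ext hc _ _ fun n ↦ H n.down
  let a (n : ℕ) : c.pt ⟶ X := π n - π n ≫ h.r ≫ h.i + π (n + 1) ≫ h.r ≫ h.i
  let ψ : c.pt ⟶ c.pt := l a
  let b (n : ℕ) : c.pt ⟶ X := match n with
    | 0 => π 0 - π 0 ≫ h.r ≫ h.i
    | n + 1 => π (n + 1) - π (n + 1) ≫ h.r ≫ h.i + π n ≫ h.r ≫ h.i
  let φ : c.pt ⟶ c.pt := l b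
  let j (n : ℕ) : M ⟶ X := match n with
    | 0 => h.i
    | n + 1 => 0
  let s : M ⟶ c.pt := l j
  have hψ (n : ℕ) : ψ ≫ π n = π n - π n ≫ h.r ≫ h.i + π (n + 1) ≫ h.r ≫ h.i :=
    hl a n
  have hφ (n : ℕ) : φ ≫ π (n + 1) = π (n + 1) - π (n + 1) ≫ h.r ≫ h.i + π n ≫ h.r ≫ h.i :=
    hl b (n + 1)
  have hφ₀ : φ ≫ π 0 = π 0 - π 0 ≫ h.r ≫ h.i := hl b 0
  have hs (n : ℕ) : s ≫ π (n + 1) = 0 := hl j (n + 1)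
  have hs₀ : s ≫ π 0 = h.i := hl j 0
  refine nonempty_iso_biprod φ ψ s (π 0 ≫ h.r) (hext _ _ fun n ↦ ?_) ?_ (hext _ _ fun n ↦ ?_) ?_
    (hext _ _ fun n ↦ ?_)
  · rcases n with - | n <;>
      simp [hψ, reassoc_of% hφ, reassoc_of% hφ₀, hφ, hφ₀, Preadditive.sub_comp,
        Preadditive.add_comp]
  · simp [reassoc_of% hφ₀, Preadditive.sub_comp]
  · rcases n with - | n <;>
      simp [hψ, reassoc_of% hs, reassoc_of% hs₀, hs, hs₀]
  · simp [reassoc_of% hs₀]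
  · rcases n with - | n <;>
      simp [hφ, hφ₀, hs, hs₀, hψ, reassoc_of% hψ, Preadditive.sub_comp, Preadditive.add_comp]

end Swindle

section Pretriangulated

variable {D : Type*} [Category* D] [HasZeroObject D] [HasShift D ℤ] [Preadditive D]
  [∀ n : ℤ, (shiftFunctor D n).Additive] [Pretriangulated D]

/-- A property stable under isomorphisms and cones passes from `Y` to `M` if `Y ≅ Y ⊞ M`. -/
theorem of_nonempty_iso_biprod (P : D → Prop) (hiso : ∀ X Y : D, (X ≅ Y) → P X → P Y)
    (hcone : ∀ T : Triangle D, (T ∈ distTriang D) → P T.obj₁ → P T.obj₂ → P T.obj₃)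
    {Y M : D} (h : Nonempty (Y ≅ Y ⊞ M)) (hY : P Y) : P M :=
  hcone _ (binaryBiproductTriangle_distinguished Y M) hY (hiso _ _ h.some hY)

end Pretriangulated

section Stalk

variable {C : Type u} [Category.{v} C] [Abelian C] [HasDerivedCategory.{w} C]

theorem exists_not_isZero_homology {Z : DerivedCategory C} (hZ : ¬ IsZero Z) :
    ∃ n : ℤ, ¬ IsZero ((homologyFunctor C n).obj Z) := by
  by_contra! h
  have : IsIso (0 : Z ⟶ Z) := (isIso_iff C _).2 fun n ↦
    ⟨0, (h n).eq_of_src _ _, (h n).eq_of_src _ _⟩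
  exact hZ ((IsZero.iff_id_eq_zero Z).2 (by rw [← IsIso.hom_inv_id (0 : Z ⟶ Z), zero_comp]))

/-- Suppose that subobjects of projectives are projective and quotients of injectives are
injective. Let `P` be a property of objects of the derived category which is stable under
isomorphisms, shifts and cones, and such that any retract of an object satisfying `P` is absorbed
by an object satisfying `P`. If `P` holds for a nonzero object, it holds for a nonzero stalk
complex. -/
theorem exists_stalk [EnoughProjectives C] [EnoughInjectives C]
    (hP : ∀ {P P' : C} (j : P ⟶ P') [Mono j] [Projective P'], Projective P)
    (hI : ∀ {E F : C} (p : E ⟶ F) [Epi p] [Injective E], Injective F)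
    (P : DerivedCategory C → Prop) (hiso : ∀ X Y : DerivedCategory C, (X ≅ Y) → P X → P Y)
    (hshift : ∀ (X : DerivedCategory C) (k : ℤ), P X → P (X⟦k⟧))
    (hcone : ∀ T : Triangle (DerivedCategory C), (T ∈ distTriang (DerivedCategory C)) →
      P T.obj₁ → P T.obj₂ → P T.obj₃)
    (habs : ∀ X M : DerivedCategory C, Retract M X → P X → ∃ Y, P Y ∧ Nonempty (Y ≅ Y ⊞ M))
    (hne : ∃ Z, P Z ∧ ¬ IsZero Z) :
    ∃ M : C, ¬ IsZero M ∧ P ((singleFunctor C 0).obj M) := by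
  obtain ⟨Z, hZ, hZ₀⟩ := hne
  obtain ⟨n, hn⟩ := exists_not_isZero_homology hZ₀
  let e : (homologyFunctor C 0).obj (Z⟦n⟧) ≅ (homologyFunctor C n).obj Z :=
    ((homologyFunctor C 0).shiftIso n 0 n (add_zero n)).app Z
  obtain ⟨r⟩ := exists_retract_homology hP hI (Z⟦n⟧)
  obtain ⟨Y, hY, hYM⟩ := habs _ _ r (hshift Z n hZ)
  exact ⟨_, fun h ↦ hn (h.of_iso e.symm), of_nonempty_iso_biprod P hiso hcone hYM hY⟩

end Stalk

end Hereditary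

/-- Let `A` be a left hereditary ring (every left ideal is projective).
Then every nonzero localizing subcategory (full triangulated, closed under coproducts) and
every nonzero colocalizing subcategory (closed under products) of `D(A)` contains a nonzero
`A`-module (as a stalk complex in degree `0`). -/
theorem stmt7 {A : Type u} [Ring A] [HasDerivedCategory.{u} (ModuleCat.{u} A)]
    (hhered : ∀ I : Submodule A A, Module.Projective A ↥I) :
    (∀ P : DerivedCategory (ModuleCat.{u} A) → Prop,
      (∀ X Y : DerivedCategory (ModuleCat.{u} A), (X ≅ Y) → P X → P Y) →
      (∀ (X : DerivedCategory (ModuleCat.{u} A)) (k : ℤ), P X → P (X⟦k⟧)) →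
      (∀ T : Triangle (DerivedCategory (ModuleCat.{u} A)),
        (T ∈ distTriang (DerivedCategory (ModuleCat.{u} A))) →
        P T.obj₁ → P T.obj₂ → P T.obj₃) →
      (∀ (ι : Type u) (f : ι → DerivedCategory (ModuleCat.{u} A)) (c : Cofan f),
        IsColimit c → (∀ i, P (f i)) → P c.pt) →
      (∃ Z, P Z ∧ ¬ IsZero Z) →
      ∃ M : ModuleCat.{u} A, ¬ IsZero M ∧
        P ((singleFunctor (ModuleCat.{u} A) 0).obj M)) ∧
    (∀ P : DerivedCategory (ModuleCat.{u} A) → Prop,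
      (∀ X Y : DerivedCategory (ModuleCat.{u} A), (X ≅ Y) → P X → P Y) →
      (∀ (X : DerivedCategory (ModuleCat.{u} A)) (k : ℤ), P X → P (X⟦k⟧)) →
      (∀ T : Triangle (DerivedCategory (ModuleCat.{u} A)),
        (T ∈ distTriang (DerivedCategory (ModuleCat.{u} A))) →
        P T.obj₁ → P T.obj₂ → P T.obj₃) →
      (∀ (ι : Type u) (f : ι → DerivedCategory (ModuleCat.{u} A)) (c : Fan f),
        IsLimit c → (∀ i, P (f i)) → P c.pt) →
      (∃ Z, P Z ∧ ¬ IsZero Z) →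
      ∃ M : ModuleCat.{u} A, ¬ IsZero M ∧
        P ((singleFunctor (ModuleCat.{u} A) 0).obj M)) := by
  have hP {P P' : ModuleCat.{u} A} (j : P ⟶ P') [Mono j] [Projective P'] : Projective P :=
    Hereditary.projective_of_mono hhered j
  have hI {E F : ModuleCat.{u} A} (p : E ⟶ F) [Epi p] [Injective E] : Injective F :=
    Hereditary.injective_of_epi hhered p
  refine ⟨fun P hiso hshift hcone hcoprod hne ↦ ?_, fun P hiso hshift hcone hprod hne ↦ ?_⟩
  · refine Hereditary.exists_stalk hP hI P hiso hshift hcone (fun X M r hX ↦ ?_) hne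
    obtain ⟨c, ⟨hc⟩⟩ := Hereditary.exists_isColimit_cofan fun _ : ULift.{u} ℕ ↦ X
    exact ⟨c.pt, hcoprod _ _ c hc fun _ ↦ hX, Hereditary.nonempty_iso_biprod_of_isColimit r c hc⟩
  · refine Hereditary.exists_stalk hP hI P hiso hshift hcone (fun X M r hX ↦ ?_) hne
    obtain ⟨c, ⟨hc⟩⟩ := Hereditary.exists_isLimit_fan fun _ : ULift.{u} ℕ ↦ X
    exact ⟨c.pt, hprod _ _ c hc fun _ ↦ hX, Hereditary.nonempty_iso_biprod_of_isLimit r c hc⟩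
end

section
/- Let A be a ring, Ω a bounded complex of injective A-modules, and M a complex concentrated in degrees 0,...,n with C = H^0(M). Then M ∈ {}^{⊥>0}Ω (i.e., Hom_{D(A)}(M, Ω[i]) = 0 for all i > 0) if and only if C ∈ B_Ω, provided Ω is concentrated in degrees 0,...,n and M's top cohomology sits in degree n. More precisely: the soft truncation triangle C[0] → M → H^n(M)[-n] induces isomorphisms Hom_{D(A)}(M, Ω[i]) ≅ Hom_{D(A)}(C[0], Ω[i]) for all i > 0. -/
open CategoryTheory Limits DerivedCategory

universe u

namespace CochainComplex

lemma isGE_truncGE_of_isZero_homology {C : Type*} [Category* C] [Abelian C]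
    (M : CochainComplex C ℤ) (m n : ℤ)
    (hM : ∀ i, m ≤ i → i < n → IsZero (M.homology i)) : (M.truncGE m).IsGE n := by
  rw [CochainComplex.isGE_iff]
  intro i hi
  rw [HomologicalComplex.exactAt_iff_isZero_homology]
  by_cases hmi : m ≤ i
  · have := M.quasiIsoAt_πTruncGE m i hmi
    exact (hM i hmi hi).of_iso
      (asIso (HomologicalComplex.homologyMap (M.πTruncGE m) i)).symm
  · exact (M.truncGE m).isZero_of_isGE m i (by lia)

end CochainComplex

namespace DerivedCategory

universe w v u'

variable {C : Type u'} [Category.{v} C] [Abelian C] [HasDerivedCategory.{w} C]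

lemma Q_map_surjective_of_isKInjective (K L : CochainComplex C ℤ) [L.IsKInjective] :
    Function.Surjective (Q.map : (K ⟶ L) → (Q.obj K ⟶ Q.obj L)) := by
  intro f
  let e := quotientCompQhIso C
  obtain ⟨g, hg⟩ := (CochainComplex.IsKInjective.Qh_map_bijective
    ((HomotopyCategory.quotient C (ComplexShape.up ℤ)).obj K) L).2
      (e.hom.app K ≫ f ≫ e.inv.app L)
  obtain ⟨φ, rfl⟩ := (HomotopyCategory.quotient C (ComplexShape.up ℤ)).map_surjective g
  refine ⟨φ, ?_⟩
  have h := e.hom.naturality φ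
  rw [← cancel_epi (e.hom.app K), ← h, Functor.comp_map, hg]
  simp

lemma eq_zero_of_isGE_of_injective {X : DerivedCategory C} (L : CochainComplex C ℤ)
    (a p q : ℤ) (hqp : q < p) [X.IsGE p] [L.IsStrictlyGE a] [L.IsStrictlyLE q]
    [∀ i, Injective (L.X i)] (f : X ⟶ Q.obj L) : f = 0 := by
  obtain ⟨K, _, ⟨e⟩⟩ := exists_iso_Q_obj_of_isGE X p
  have := CochainComplex.isKInjective_of_injective L a
  obtain ⟨φ, hφ⟩ := Q_map_surjective_of_isKInjective K L (e.inv ≫ f)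
  have hφ₀ : φ = 0 := by
    ext i
    by_cases hi : q < i
    · exact (L.isZero_of_isStrictlyLE q i hi).eq_of_tgt _ _
    · exact (K.isZero_of_isStrictlyGE p i (by lia)).eq_of_src _ _
  rw [← cancel_epi e.inv, ← hφ, hφ₀, Functor.map_zero, comp_zero]

lemma eq_zero_of_isGE_of_injective_shift {X : DerivedCategory C} (L : CochainComplex C ℤ)
    (a p q i : ℤ) (hqp : q < p + i) [X.IsGE p] [L.IsStrictlyGE a] [L.IsStrictlyLE q]
    [hL : ∀ j, Injective (L.X j)] (f : X ⟶ (Q.obj L)⟦i⟧) : f = 0 := by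
  have := L.isStrictlyGE_shift a i (a - i) (by lia)
  have := L.isStrictlyLE_shift q i (q - i) (by lia)
  have : ∀ j, Injective ((L⟦i⟧).X j) := fun j ↦ hL (j + i)
  rw [← cancel_mono ((Q.commShiftIso i).inv.app L), zero_comp]
  exact eq_zero_of_isGE_of_injective (L⟦i⟧) (a - i) p (q - i) (by lia) _

lemma precomp_mor₁_bijective {T : Pretriangulated.Triangle (DerivedCategory C)}
    (hT : T ∈ distTriang (DerivedCategory C)) {Y : DerivedCategory C}
    (h₀ : ∀ f : T.obj₃ ⟶ Y, f = 0) (h₁ : ∀ f : T.obj₃⟦(-1 : ℤ)⟧ ⟶ Y, f = 0) :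
    Function.Bijective (fun f : T.obj₂ ⟶ Y ↦ T.mor₁ ≫ f) := by
  constructor
  · intro f g hfg
    obtain ⟨k, hk⟩ := T.yoneda_exact₂ hT (f - g) (by
      rw [Preadditive.comp_sub, sub_eq_zero]; exact hfg)
    rwa [h₀ k, comp_zero, sub_eq_zero] at hk
  · intro f
    obtain ⟨g, hg⟩ := T.invRotate.yoneda_exact₂ (Pretriangulated.inv_rot_of_distTriang _ hT) f
      (h₁ _)
    exact ⟨g, hg.symm⟩

lemma nonempty_Q_truncLE_iso_singleFunctor (M : CochainComplex C ℤ) (n : ℤ)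
    [M.IsStrictlyGE n] :
    Nonempty (Q.obj (M.truncLE n) ≅ (singleFunctor C n).obj (M.homology n)) := by
  obtain ⟨Y, ⟨e⟩⟩ := (M.truncLE n).exists_iso_single n
  let e' : M.homology n ≅ Y :=
    (asIso (HomologicalComplex.homologyMap (M.ιTruncLE n) n)).symm ≪≫
      (HomologicalComplex.homologyFunctor C _ n).mapIso e ≪≫
      (HomologicalComplex.homologyFunctorSingleIso C (ComplexShape.up ℤ) n).app Y
  exact ⟨Q.mapIso e ≪≫ ((singleFunctorIsoCompQ C n).app Y).symm ≪≫
    (singleFunctor C n).mapIso e'.symm⟩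

end DerivedCategory

/-- (Dual key lemma.)  Let `W` be a complex of injective `A`-modules
concentrated in degrees `0,...,n` and `M` a complex concentrated in degrees `0,...,n` with
`C = H^0(M)`.  Then the soft truncation triangle induces, for every `i > 0`, isomorphisms
`Hom_{D(A)}(M, W[i]) ≅ Hom_{D(A)}(C[0], W[i])`; in particular `M ∈ ^{⊥>0}W` iff
`C ∈ B_W`. -/
theorem stmt19 {A : Type u} [Ring A] [HasDerivedCategory.{u} (ModuleCat.{u} A)]
    (n : ℕ) (W M : CochainComplex (ModuleCat.{u} A) ℤ)
    (hWb : ∀ i : ℤ, (i < 0 ∨ (n : ℤ) < i) → IsZero (W.X i))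
    (hWinj : ∀ i : ℤ, Injective (W.X i))
    (hMb : ∀ i : ℤ, (i < 0 ∨ (n : ℤ) < i) → IsZero (M.X i))
    (hME : ∀ i : ℤ, 0 < i → i < (n : ℤ) → IsZero (M.homology i)) :
    (∀ i : ℤ, 0 < i →
      Nonempty ((Q.obj M ⟶ (Q.obj W)⟦i⟧) ≃+
        (((singleFunctor (ModuleCat.{u} A) 0).obj (M.homology 0)) ⟶ (Q.obj W)⟦i⟧))) ∧
    ((∀ i : ℤ, 0 < i → ∀ φ : Q.obj M ⟶ (Q.obj W)⟦i⟧, φ = 0) ↔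
      (∀ i : ℤ, 0 < i →
        ∀ φ : ((singleFunctor (ModuleCat.{u} A) 0).obj (M.homology 0)) ⟶ (Q.obj W)⟦i⟧,
          φ = 0)) := by
  have : W.IsStrictlyGE 0 := (W.isStrictlyGE_iff 0).2 fun i hi ↦ hWb i (Or.inl hi)
  have : W.IsStrictlyLE n := (W.isStrictlyLE_iff n).2 fun i hi ↦ hWb i (Or.inr hi)
  have : M.IsStrictlyGE 0 := (M.isStrictlyGE_iff 0).2 fun i hi ↦ hMb i (Or.inl hi)
  let S := M.shortComplexTruncLE 0
  have hS : S.ShortExact := M.shortComplexTruncLE_shortExact 0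
  have hX₃ : (triangleOfSES hS).obj₃.IsGE (n : ℤ) := by
    have := CochainComplex.isGE_truncGE_of_isZero_homology M 1 n fun i hi hin ↦ hME i (by lia) hin
    exact TStructure.t.isGE_of_iso
      (asIso (Q.map (M.shortComplexTruncLEX₃ToTruncGE 0 1 (by lia)))).symm n
  have : ((triangleOfSES hS).obj₃⟦(-1 : ℤ)⟧).IsGE ((n : ℤ) + 1) :=
    TStructure.t.isGE_shift _ (n : ℤ) (-1) (n + 1) (by lia)
  obtain ⟨e⟩ := nonempty_Q_truncLE_iso_singleFunctor M 0
  let u : (singleFunctor (ModuleCat.{u} A) 0).obj (M.homology 0) ⟶ Q.obj M :=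
    e.inv ≫ Q.map (M.ιTruncLE 0)
  have hu (i : ℤ) (hi : 0 < i) :
      Function.Bijective (Preadditive.leftComp ((Q.obj W)⟦i⟧) u) := by
    have hT := precomp_mor₁_bijective (triangleOfSES_distinguished hS) (Y := (Q.obj W)⟦i⟧)
      (eq_zero_of_isGE_of_injective_shift W 0 n n i (by lia))
      (eq_zero_of_isGE_of_injective_shift W 0 (n + 1) n i (by lia))
    have hE : ⇑(Preadditive.leftComp ((Q.obj W)⟦i⟧) u) =
        e.homCongr (Iso.refl ((Q.obj W)⟦i⟧)) ∘ fun φ ↦ Q.map (M.ιTruncLE 0) ≫ φ := by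
      funext φ
      change (e.inv ≫ Q.map (M.ιTruncLE 0)) ≫ φ = _
      simp
    rw [hE]
    exact (e.homCongr (Iso.refl _)).bijective.comp hT
  refine ⟨fun i hi ↦ ⟨AddEquiv.ofBijective _ (hu i hi)⟩, forall₂_congr fun i hi ↦ ?_⟩
  let E := AddEquiv.ofBijective _ (hu i hi)
  exact ⟨fun h φ ↦ E.symm.injective ((h _).trans (map_zero E.symm).symm),
    fun h φ ↦ E.injective ((h _).trans (map_zero E).symm)⟩
end
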